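/- arXiv:0907.2499 — 4 statements merged into one kernel-verified Lean document; each statement's English description precedes it below -/
import Mathlib

section
/- Let p₁ < p₂ < ⋯ be the increasing enumeration of the prime numbers congruent to 1 modulo 3, and for n ≥ 1 set N_n = p₁ · p₂ ⋯ p_n. Then there exists a constant C > 0 such that for all sufficiently large n, N_n / φ(N_n) ≥ C · √(log (log N_n)), where φ denotes Euler's totient function. -/
open Finset



namespace TotAux

/-- the nontrivial character mod 3 -/
noncomputable def chi (n : ℕ) : ℝ := if n % 3 = 1 then 1 else if n % 3 = 2 then -1 else 0

lemma chi_mul (m n : ℕ) : chi (m * n) = chi m * chi n := by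
  unfold chi
  have hm : m % 3 < 3 := Nat.mod_lt _ (by norm_num)
  have hn : n % 3 < 3 := Nat.mod_lt _ (by norm_num)
  rw [Nat.mul_mod]
  generalize m % 3 = a at *
  generalize n % 3 = b at *
  interval_cases a <;> interval_cases b <;> norm_num

noncomputable def fa : ArithmeticFunction ℝ := ⟨fun n => (n : ℝ)⁻¹, by simp⟩
noncomputable def fb : ArithmeticFunction ℝ := ⟨fun n => chi n * (n : ℝ)⁻¹, by simp⟩

lemma fa_mul (m n : ℕ) : fa (m * n) = fa m * fa n := by
  simp [fa, mul_comm]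
lemma fb_mul (m n : ℕ) : fb (m * n) = fb m * fb n := by
  simp [fb, chi_mul]; ring
lemma fa_one : fa 1 = 1 := by simp [fa]
lemma fb_one : fb 1 = 1 := by simp [fb, chi]
lemma fa_pow (m k : ℕ) : fa (m ^ k) = fa m ^ k := by
  induction k with
  | zero => simp [fa_one]
  | succ k ih => rw [pow_succ, pow_succ, fa_mul, ih]
lemma fb_pow (m k : ℕ) : fb (m ^ k) = fb m ^ k := by
  induction k with
  | zero => simp [fb_one]
  | succ k ih => rw [pow_succ, pow_succ, fb_mul, ih]

noncomputable def ff : ArithmeticFunction ℝ := fa * fb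

lemma ff_mult : ff.IsMultiplicative :=
  ArithmeticFunction.IsMultiplicative.mul ⟨fa_one, fun _ => fa_mul _ _⟩ ⟨fb_one, fun _ => fb_mul _ _⟩

lemma ff_pow (q k : ℕ) (hq : q.Prime) :
    ff (q ^ k) = ∑ kl ∈ antidiagonal k, fa q ^ kl.1 * fb q ^ kl.2 := by
  rw [ff, ArithmeticFunction.mul_apply, Nat.sum_divisorsAntidiagonal (f := fun i j => fa i * fb j),
    Nat.sum_divisors_prime_pow hq, Finset.Nat.sum_antidiagonal_eq_sum_range_succ_mk]
  refine Finset.sum_congr rfl fun i hi => ?_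
  rw [Nat.pow_div (by simpa [Nat.lt_succ_iff] using hi) hq.pos, fa_pow, fb_pow]

lemma ff_pow_nonneg (q k : ℕ) (hq : q.Prime) : 0 ≤ ff (q ^ k) := by
  have h : ff (q ^ k) = fa q ^ k * ∑ i ∈ range (k + 1), chi q ^ i := by
    rw [ff_pow q k hq, Finset.Nat.sum_antidiagonal_eq_sum_range_succ_mk, ← Finset.sum_range_reflect,
      Finset.mul_sum]
    refine Finset.sum_congr rfl fun i hi => ?_
    have : i ≤ k := by simpa [Nat.lt_succ_iff] using hi
    have e : fb q = chi q * fa q := by simp [fa, fb]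
    obtain ⟨j, rfl⟩ := Nat.exists_eq_add_of_le this
    rw [e, mul_pow]
    simp only [show i + j + 1 - 1 - i = j by omega, show i + j - j = i by omega, pow_add]
    ring
  rw [h]
  refine mul_nonneg (pow_nonneg (by simp [fa]) _) ?_
  unfold chi
  split_ifs
  · simp; positivity
  · rw [neg_one_geom_sum]; split_ifs <;> norm_num
  · exact Finset.sum_nonneg fun i _ => by positivity

lemma ff_nonneg (n : ℕ) : 0 ≤ ff n := by
  rcases eq_or_ne n 0 with rfl | hn
  · simp
  · rw [ff_mult.multiplicative_factorization _ hn]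
    exact Finset.prod_nonneg fun q hq => ff_pow_nonneg _ _ (Nat.prime_of_mem_primeFactors hq)

lemma fa_lt (q : ℕ) (hq : q.Prime) : ‖fa q‖ < 1 := by
  have : (1:ℝ) < q := by exact_mod_cast hq.one_lt
  simp [fa]
  exact inv_lt_one_of_one_lt₀ this

lemma fb_lt (q : ℕ) (hq : q.Prime) : ‖fb q‖ < 1 := by
  refine lt_of_le_of_lt ?_ (fa_lt q hq)
  simp only [fb, fa, ArithmeticFunction.coe_mk, norm_mul]
  refine mul_le_of_le_one_left (norm_nonneg _) ?_
  unfold chi; split_ifs <;> simp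

lemma ff_summable (q : ℕ) (hq : q.Prime) : Summable (fun k : ℕ => ‖ff (q ^ k)‖) := by
  simp_rw [ff_pow q _ hq]
  exact summable_norm_sum_mul_antidiagonal_of_summable_norm
    (f := fun n => fa q ^ n) (g := fun n => fb q ^ n)
    (summable_norm_geometric_of_norm_lt_one (fa_lt q hq))
    (summable_norm_geometric_of_norm_lt_one (fb_lt q hq))

lemma ff_tsum (q : ℕ) (hq : q.Prime) :
    ∑' k : ℕ, ff (q ^ k) = (1 - fa q)⁻¹ * (1 - fb q)⁻¹ := by
  simp_rw [ff_pow q _ hq]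
  rw [← tsum_mul_tsum_eq_tsum_sum_antidiagonal_of_summable_norm
    (f := fun n => fa q ^ n) (g := fun n => fb q ^ n)
    (summable_norm_geometric_of_norm_lt_one (fa_lt q hq))
    (summable_norm_geometric_of_norm_lt_one (fb_lt q hq)),
    tsum_geometric_of_norm_lt_one (fa_lt q hq), tsum_geometric_of_norm_lt_one (fb_lt q hq)]

lemma sum_le_prod (x : ℕ) :
    ∑ n ∈ Ioc 0 x, ff n ≤ ∏ q ∈ (x + 1).primesBelow, ((1 - fa q)⁻¹ * (1 - fb q)⁻¹) := by
  have H := (EulerProduct.summable_and_hasSum_smoothNumbers_prod_primesBelow_tsum (f := ff)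
    ff_mult.1 (fun h => ff_mult.2 h) (fun {p} hp => ff_summable p hp) (x + 1)).2
  rw [Finset.prod_congr rfl (fun q hq => ff_tsum q (Nat.prime_of_mem_primesBelow hq))] at H
  have hmem : ∀ n ∈ Ioc 0 x, n ∈ (x + 1).smoothNumbers := by
    intro n hn
    rw [mem_Ioc] at hn
    exact Nat.mem_smoothNumbers_of_lt hn.1 (by omega)
  have := sum_le_hasSum ((Ioc 0 x).subtype (· ∈ (x + 1).smoothNumbers))
    (fun i _ => ff_nonneg i) H
  rwa [Finset.sum_subtype_of_mem (f := fun n => ff n) hmem] at this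

lemma fb_sum_ge (m : ℕ) : (1/2 : ℝ) ≤ ∑ n ∈ Ioc 0 (3 * m + 2), fb n ∧
    (1/2 : ℝ) + 1 / (3 * m + 4) ≤ ∑ n ∈ Ioc 0 (3 * m + 4), fb n ∧
    (1/2 : ℝ) ≤ ∑ n ∈ Ioc 0 (3 * m + 3), fb n := by
  have h1 : ∀ m, fb (3 * m + 1) = 1 / (3 * m + 1) := by
    intro m; simp [fb, chi, Nat.add_mod]
  have h2 : ∀ m, fb (3 * m + 2) = - 1 / (3 * m + 2) := by
    intro m; simp [fb, chi, Nat.add_mod]; ring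
  have h3 : ∀ m, fb (3 * m + 3) = 0 := by
    intro m; simp [fb, chi, Nat.add_mod]
  have key : (1/2 : ℝ) ≤ ∑ n ∈ Ioc 0 (3 * m + 2), fb n := by
    induction m with
    | zero =>
      have a := h1 0
      have b := h2 0
      simp [Finset.sum_Ioc_succ_top] at a b ⊢
      rw [a, b]; norm_num
    | succ m ih =>
      rw [show 3 * (m + 1) + 2 = 3 * m + 4 + 1 by ring, Finset.sum_Ioc_succ_top (by omega),
        Finset.sum_Ioc_succ_top (by omega), Finset.sum_Ioc_succ_top (by omega), h3 m,
        show 3 * m + 3 + 1 = 3 * (m + 1) + 1 by ring, h1,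
        show 3 * (m + 1) + 1 + 1 = 3 * (m + 1) + 2 by ring, h2]
      have : (0:ℝ) ≤ 1 / (3 * (m + 1 : ℕ) + 1) + (-1) / (3 * (m + 1 : ℕ) + 2) := by
        rw [div_add_div _ _ (by positivity) (by positivity)]
        apply div_nonneg
        · linarith
        · positivity
      linarith
  have k3 : ∑ n ∈ Ioc 0 (3 * m + 3), fb n = ∑ n ∈ Ioc 0 (3 * m + 2), fb n := by
    rw [Finset.sum_Ioc_succ_top (by omega), h3 m, add_zero]
  refine ⟨key, ?_, k3 ▸ key⟩
  rw [Finset.sum_Ioc_succ_top (by omega), k3, show 3 * m + 3 + 1 = 3 * (m + 1) + 1 by ring, h1]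
  push_cast
  rw [show (3 * ((m:ℝ) + 1) + 1) = 3 * m + 4 by ring]
  linarith

lemma fb_sum_ge' (y : ℕ) (hy : 0 < y) : (1/2 : ℝ) ≤ ∑ n ∈ Ioc 0 y, fb n := by
  have hc : y = 1 ∨ (∃ m, y = 3 * m + 2) ∨ (∃ m, y = 3 * m + 4) ∨ ∃ m, y = 3 * m + 3 := by
    rcases (by omega : y = 1 ∨ y = 3 * ((y - 2) / 3) + 2 ∨ y = 3 * ((y - 2) / 3) + 4 ∨
      y = 3 * ((y - 2) / 3) + 3) with h | h | h | h
    · exact Or.inl h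
    · exact Or.inr (Or.inl ⟨_, h⟩)
    · exact Or.inr (Or.inr (Or.inl ⟨_, h⟩))
    · exact Or.inr (Or.inr (Or.inr ⟨_, h⟩))
  rcases hc with
    rfl | ⟨m, rfl⟩ | ⟨m, rfl⟩ | ⟨m, rfl⟩
  · simp [fb_one]; norm_num
  · exact (fb_sum_ge m).1
  · have := (fb_sum_ge m).2.1
    have h : (0:ℝ) ≤ 1 / (3 * m + 4) := by positivity
    linarith
  · exact (fb_sum_ge m).2.2

lemma log_le_sum (x : ℕ) : (1/2 : ℝ) * Real.log (x + 1 : ℕ) ≤ ∑ n ∈ Ioc 0 x, ff n := by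
  rw [ff, ArithmeticFunction.sum_Ioc_mul_eq_sum_sum]
  have h := log_add_one_le_harmonic x
  rw [harmonic_eq_sum_Icc] at h
  push_cast at h ⊢
  calc (1/2 : ℝ) * Real.log (x + 1) ≤ ∑ i ∈ Icc 1 x, (i : ℝ)⁻¹ * (1/2) := by
        rw [← Finset.sum_mul]; linarith
    _ ≤ _ := by
      refine Finset.sum_le_sum fun i hi => ?_
      have hi' : 1 ≤ i ∧ i ≤ x := by simpa using hi
      exact mul_le_mul_of_nonneg_left (fb_sum_ge' _ (Nat.div_pos hi'.2 hi'.1)) (by positivity)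

lemma prod_b (x : ℕ) : ∏ k ∈ Ico 2 (x + 2), ((k : ℝ)^2 / ((k : ℝ)^2 - 1)) =
    2 * ((x : ℝ) + 1) / ((x : ℝ) + 2) := by
  induction x with
  | zero => simp
  | succ x ih =>
    rw [show x + 1 + 2 = (x + 2) + 1 by ring, Finset.prod_Ico_succ_top (by omega), ih]
    push_cast
    have : ((x:ℝ) + 2)^2 - 1 ≠ 0 := by
      have : (0:ℝ) ≤ x := by positivity
      nlinarith
    field_simp
    ring

lemma one_le_b (k : ℕ) (hk : 2 ≤ k) : (1:ℝ) ≤ (k : ℝ)^2 / ((k : ℝ)^2 - 1) := by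
  have : (2:ℝ) ≤ k := by exact_mod_cast hk
  rw [le_div_iff₀ (by nlinarith)]; linarith

lemma prod_b_le (x : ℕ) : ∏ k ∈ x.primesBelow, ((k : ℝ)^2 / ((k : ℝ)^2 - 1)) ≤ 2 := by
  calc _ ≤ ∏ k ∈ Ico 2 (x + 2), ((k : ℝ)^2 / ((k : ℝ)^2 - 1)) := by
        have hsub : x.primesBelow ⊆ Ico 2 (x + 2) := by
          intro q hq
          have := (Nat.prime_of_mem_primesBelow hq).two_le
          have := Nat.lt_of_mem_primesBelow hq
          simp; omega
        rw [← Finset.prod_sdiff hsub]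
        refine le_mul_of_one_le_left (Finset.prod_nonneg fun k hk => ?_)
          (Finset.one_le_prod fun k hk => ?_)
        · have := one_le_b k (Nat.prime_of_mem_primesBelow hk).two_le; linarith
        · exact one_le_b k (by simp at hk; omega)
    _ ≤ 2 := by
      rw [prod_b, div_le_iff₀ (by positivity)]; linarith

noncomputable def ga (q : ℕ) : ℝ := if q % 3 = 1 then (q : ℝ) / (q - 1) else 1
noncomputable def gc (q : ℕ) : ℝ := if q = 3 then 3 / 2 else 1

lemma local_le (q : ℕ) (hq : q.Prime) :
    (1 - fa q)⁻¹ * (1 - fb q)⁻¹ ≤ ga q ^ 2 * ((q : ℝ)^2 / ((q : ℝ)^2 - 1)) * gc q := by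
  have h2 : (2:ℝ) ≤ q := by exact_mod_cast hq.two_le
  have hb := one_le_b q hq.two_le
  have hc : 1 ≤ gc q := by unfold gc; split_ifs <;> norm_num
  have hfa : fa q = (q:ℝ)⁻¹ := rfl
  have hfb : fb q = chi q * (q:ℝ)⁻¹ := rfl
  have hi : (1 - (q:ℝ)⁻¹)⁻¹ = q / (q - 1) := by
    rw [← one_div_div]; field_simp
  rw [hfa, hfb, hi]
  rcases (by omega : q % 3 = 0 ∨ q % 3 = 1 ∨ q % 3 = 2) with h | h | h
  · have : q = 3 := ((Nat.prime_dvd_prime_iff_eq Nat.prime_three hq).1 (Nat.dvd_of_mod_eq_zero h)).symm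
    subst this
    norm_num [chi, ga, gc]
  · simp only [chi, ga, h, if_true, one_mul, hi]
    have : (0:ℝ) ≤ q / (q - 1) * (q / (q - 1)) := mul_self_nonneg _
    rw [pow_two, mul_assoc (_ * _)]
    exact le_mul_of_one_le_right this (by nlinarith)
  · simp only [chi, ga, h]
    have e : (q:ℝ) / (q - 1) * (1 - -1 * (q:ℝ)⁻¹)⁻¹ = (q : ℝ)^2 / ((q : ℝ)^2 - 1) := by
      have h1 : (q:ℝ) - 1 ≠ 0 := by intro h; linarith
      have h3 : (q:ℝ) + 1 ≠ 0 := by intro h; linarith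
      have h4 : (q:ℝ)^2 - 1 ≠ 0 := by intro h; nlinarith
      have h5 : (1 - -1 * (q:ℝ)⁻¹)⁻¹ = q / (q + 1) := by
        rw [← one_div_div]; field_simp; ring
      rw [h5, div_mul_div_comm]; congr 1 <;> ring
    norm_num at e ⊢
    rw [e]
    exact le_mul_of_one_le_right (by linarith) hc

lemma main_bound (x : ℕ) :
    Real.log (x + 1 : ℕ) ≤ 6 * (∏ q ∈ (x + 1).primesBelow with q % 3 = 1, ((q : ℝ) / (q - 1))) ^ 2 := by
  have h := (log_le_sum x).trans (sum_le_prod x)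
  have h' : ∏ q ∈ (x + 1).primesBelow, ((1 - fa q)⁻¹ * (1 - fb q)⁻¹) ≤
      ∏ q ∈ (x + 1).primesBelow, (ga q ^ 2 * ((q : ℝ)^2 / ((q : ℝ)^2 - 1)) * gc q) := by
    refine Finset.prod_le_prod (fun q hq => ?_) fun q hq => local_le q (Nat.prime_of_mem_primesBelow hq)
    have hq := Nat.prime_of_mem_primesBelow hq
    rw [← ff_tsum q hq]
    exact tsum_nonneg fun k => ff_nonneg _
  replace h := h.trans h'
  rw [Finset.prod_mul_distrib, Finset.prod_mul_distrib, Finset.prod_pow] at h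
  have hg : ∏ q ∈ (x + 1).primesBelow, ga q =
      ∏ q ∈ (x + 1).primesBelow with q % 3 = 1, ((q : ℝ) / (q - 1)) := by
    rw [Finset.prod_filter]; rfl
  have hc : ∏ q ∈ (x + 1).primesBelow, gc q ≤ 3 / 2 := by
    unfold gc
    rw [Finset.prod_ite_eq' (x + 1).primesBelow 3 (fun _ => (3/2 : ℝ))]
    split_ifs <;> norm_num
  have hc0 : 0 ≤ ∏ q ∈ (x + 1).primesBelow, gc q :=
    Finset.prod_nonneg fun q _ => by unfold gc; split_ifs <;> norm_num
  rw [hg] at h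
  set A := ∏ q ∈ (x + 1).primesBelow with q % 3 = 1, ((q : ℝ) / (q - 1))
  have hb := prod_b_le (x + 1)
  have : A ^ 2 * (∏ k ∈ (x+1).primesBelow, ((k : ℝ)^2 / ((k : ℝ)^2 - 1))) *
      ∏ q ∈ (x + 1).primesBelow, gc q ≤ A ^ 2 * 2 * (3 / 2) := by gcongr
  linarith

end TotAux

theorem totient_ratio_ge_sqrt_log_log
    (p : ℕ → ℕ) (hmono : StrictMono p)
    (hp : ∀ n, (p n).Prime ∧ p n % 3 = 1)
    (hall : ∀ q : ℕ, q.Prime → q % 3 = 1 → ∃ n, p n = q)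
    (N : ℕ → ℕ) (hN : ∀ n, N n = ∏ i ∈ Finset.range n, p i) :
    ∃ C : ℝ, 0 < C ∧ ∃ n₀ : ℕ, ∀ n ≥ n₀,
      (N n : ℝ) / (Nat.totient (N n) : ℝ) ≥
        C * Real.sqrt (Real.log (Real.log (N n : ℝ))) := by
  refine ⟨1/4, by norm_num, 1, fun n hn => ?_⟩
  obtain ⟨m, rfl⟩ : ∃ m, n = m + 1 := ⟨n - 1, by omega⟩
  have hset : (p m + 1).primesBelow.filter (fun q => q % 3 = 1) = (range (m + 1)).image p := by
    ext q
    simp only [Finset.mem_filter, Nat.mem_primesBelow, Finset.mem_image, Finset.mem_range]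
    constructor
    · rintro ⟨⟨h1, h2⟩, h3⟩
      obtain ⟨k, rfl⟩ := hall q h2 h3
      exact ⟨k, by have := hmono.le_iff_le.1 (Nat.lt_succ_iff.1 h1); omega, rfl⟩
    · rintro ⟨k, hk, rfl⟩
      exact ⟨⟨Nat.lt_succ_iff.2 (hmono.monotone (by omega)), (hp k).1⟩, (hp k).2⟩
  have htot : ∀ k, (N k : ℝ) / (Nat.totient (N k) : ℝ) = ∏ i ∈ range k, ((p i : ℝ) / (p i - 1)) := by
    intro k
    induction k with
    | zero => simp [hN]
    | succ k ih =>
      have hs : N (k + 1) = N k * p k := by rw [hN, hN, Finset.prod_range_succ]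
      have hcop : Nat.Coprime (N k) (p k) := by
        rw [hN]
        refine Nat.Coprime.prod_left fun i hi => ?_
        exact (Nat.coprime_primes (hp i).1 (hp k).1).2
          (hmono (Finset.mem_range.1 hi)).ne
      rw [hs, Nat.totient_mul hcop, Nat.totient_prime (hp k).1, Finset.prod_range_succ, ← ih]
      push_cast [Nat.cast_sub (hp k).1.one_le]
      rw [div_mul_div_comm]
  have hmain := TotAux.main_bound (p m)
  rw [hset, Finset.prod_image (fun a _ b _ h => hmono.injective h), ← htot] at hmain
  set A := (N (m+1) : ℝ) / (Nat.totient (N (m+1)) : ℝ)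
  have hA : 0 ≤ A := by positivity
  have hNle : N (m + 1) ≤ 4 ^ (p m) := by
    refine le_trans ?_ (primorial_le_four_pow (p m))
    rw [hN, ← Finset.prod_image (f := fun x => x) (fun a _ b _ h => hmono.injective h), ← hset, primorial]
    refine Finset.prod_le_prod_of_subset_of_one_le' ?_ ?_
    · intro q hq
      simp only [Finset.mem_filter, Nat.mem_primesBelow, Finset.mem_range] at hq ⊢
      simp [hq.1]
    · intro q hq _
      simp only [Finset.mem_filter] at hq
      exact hq.2.one_le
  have hNpos : 0 < N (m + 1) := by
    rw [hN]; exact Finset.prod_pos fun i _ => (hp i).1.pos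
  have hpm : (2:ℝ) ≤ p m := by exact_mod_cast (hp m).1.two_le
  have hlog : Real.log (N (m + 1)) ≤ (p m + 1 : ℝ) ^ 2 := by
    have h1 : Real.log (N (m + 1)) ≤ Real.log ((4:ℝ) ^ (p m)) :=
      Real.log_le_log (by exact_mod_cast hNpos) (by exact_mod_cast hNle)
    rw [Real.log_pow] at h1
    have h4 : Real.log 4 ≤ 4 - 1 := Real.log_le_sub_one_of_pos (by norm_num)
    nlinarith
  have hlog0 : 0 ≤ Real.log (N (m + 1)) := Real.log_natCast_nonneg _
  have hll : Real.log (Real.log (N (m + 1))) ≤ 2 * Real.log (p m + 1) := by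
    rcases hlog0.eq_or_lt with h | h
    · rw [← h, Real.log_zero]
      have := Real.log_nonneg (show (1:ℝ) ≤ p m + 1 by linarith)
      linarith
    · refine (Real.log_le_log h hlog).trans ?_
      rw [Real.log_pow]; norm_num
  push_cast at hmain
  have hs : Real.sqrt (Real.log (Real.log (N (m + 1) : ℝ))) ≤ 4 * A := by
    rw [Real.sqrt_le_left (by positivity)]
    nlinarith
  show 1/4 * _ ≤ A
  linarith
end

section
/- There exists a constant K > 0 such that, as x → ∞, the quantity ( ∏_{p ≤ x, p prime, p ≡ 1 (mod 3)} (1 − 1/p)^{−1} ) / √(log x) tends to K. -/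
open Filter

noncomputable def chi3 (n : ℕ) : ℝ := if n % 3 = 1 then 1 else if n % 3 = 2 then -1 else 0

noncomputable def X3 (n : ℕ) : ℝ := if n % 3 = 2 then 1 else 0

lemma chi3_eq (n : ℕ) : chi3 n = X3 (n + 1) - X3 n := by
  unfold chi3 X3
  have : n % 3 = 0 ∨ n % 3 = 1 ∨ n % 3 = 2 := by omega
  rcases this with h | h | h <;> simp [h, Nat.add_mod]

lemma X3_nonneg (n : ℕ) : 0 ≤ X3 n := by unfold X3; split_ifs <;> norm_num
lemma X3_le (n : ℕ) : X3 n ≤ 1 := by unfold X3; split_ifs <;> norm_num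

lemma abs_chi3_le (n : ℕ) : |chi3 n| ≤ 1 := by
  unfold chi3; split_ifs <;> norm_num

lemma chi3_mul (m n : ℕ) : chi3 (m * n) = chi3 m * chi3 n := by
  unfold chi3
  have h1 : m % 3 = 0 ∨ m % 3 = 1 ∨ m % 3 = 2 := by omega
  have h2 : n % 3 = 0 ∨ n % 3 = 1 ∨ n % 3 = 2 := by omega
  rcases h1 with h | h | h <;> rcases h2 with h' | h' | h' <;> simp [h, h', Nat.mul_mod]

/-- Partial summation bound for sums of the character against an antitone function. -/
lemma abs_sum_chi3_le (g : ℕ → ℝ) (M N : ℕ) (hMN : M ≤ N)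
    (hg : ∀ n, M < n → g (n + 1) ≤ g n) (hg0 : ∀ n, M < n → 0 ≤ g n) :
    |∑ m ∈ Finset.Ioc M N, chi3 m * g m| ≤ g (M + 1) := by
  rcases hMN.eq_or_lt with rfl | hlt
  · simpa using hg0 (M + 1) (by omega)
  have key : ∀ N, M + 1 ≤ N →
      - (X3 (M + 1) * g (M + 1)) ≤ (∑ m ∈ Finset.Ioc M N, chi3 m * g m) - X3 (N + 1) * g N ∧
      (∑ m ∈ Finset.Ioc M N, chi3 m * g m) - X3 (N + 1) * g N ≤
        - (X3 (M + 1) * g (M + 1)) + g (M + 1) - g N := by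
    intro N hN
    induction N, hN using Nat.le_induction with
    | base => simp [chi3_eq]; constructor <;> linarith
    | succ N hN ih =>
      rw [← Finset.insert_Ioc_right_eq_Ioc_add_one (by omega), Finset.sum_insert (by simp), chi3_eq]
      have h1 := hg N (by omega)
      have h2 := X3_nonneg (N + 1)
      have h3 := X3_le (N + 1)
      constructor <;> nlinarith
  obtain ⟨h1, h2⟩ := key N hlt
  have a1 := X3_nonneg (N + 1)
  have a2 := X3_le (N + 1)
  have a3 := X3_nonneg (M + 1)
  have a4 := X3_le (M + 1)
  have a5 := hg0 N hlt
  have a6 := hg0 (M + 1) (by omega)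
  rw [abs_le]
  constructor <;> nlinarith

noncomputable def T3 (N : ℕ) : ℝ := ∑ m ∈ Finset.Ioc 0 N, chi3 m / m

lemma sum_Ioc_split (f : ℕ → ℝ) {M N : ℕ} (h : M ≤ N) :
    ∑ m ∈ Finset.Ioc 0 N, f m = ∑ m ∈ Finset.Ioc 0 M, f m + ∑ m ∈ Finset.Ioc M N, f m :=
  (Finset.sum_Ioc_consecutive f (Nat.zero_le _) h).symm

lemma T3_sub (M N : ℕ) (h : M ≤ N) : |T3 N - T3 M| ≤ 1 / ((M : ℝ) + 1) := by
  have := abs_sum_chi3_le (fun n => 1 / (n : ℝ)) M N h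
    (fun n hn => by
      have : (0 : ℝ) < n := by exact_mod_cast (by omega : 0 < n)
      apply one_div_le_one_div_of_le this; push_cast; linarith)
    (fun n hn => by positivity)
  unfold T3
  rw [sum_Ioc_split _ h, add_sub_cancel_left]
  simpa [div_eq_mul_inv] using this

lemma exists_L3 : ∃ L : ℝ, 1 / 2 ≤ L ∧ ∀ M, |T3 M - L| ≤ 1 / ((M : ℝ) + 1) := by
  have hc : CauchySeq T3 := by
    refine cauchySeq_of_le_tendsto_0 (fun n : ℕ => 2 * (1 / ((n : ℝ) + 1))) ?_ ?_
    · intro n m N hn hm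
      rw [Real.dist_eq]
      have h1 := abs_le.1 (T3_sub N n hn)
      have h2 := abs_le.1 (T3_sub N m hm)
      rw [abs_le]; constructor <;> linarith
    · simpa using (tendsto_one_div_add_atTop_nhds_zero_nat (𝕜 := ℝ)).const_mul 2
  obtain ⟨L, hL⟩ := cauchySeq_tendsto_of_complete hc
  have h (M : ℕ) : |T3 M - L| ≤ 1 / ((M : ℝ) + 1) := by
    have h1 : Tendsto (fun N => |T3 N - T3 M|) atTop (nhds |L - T3 M|) :=
      (hL.sub_const _).abs
    rw [abs_sub_comm]
    exact le_of_tendsto h1 (by filter_upwards [eventually_ge_atTop M] with N hN using T3_sub M N hN)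
  refine ⟨L, ?_, h⟩
  have := abs_le.1 (h 1)
  have h1 : T3 1 = 1 := by simp [T3, chi3]
  rw [h1] at this
  norm_num at this ⊢
  linarith

lemma sum_chi3_log_bdd : ∃ C : ℝ, ∀ N : ℕ,
    |∑ m ∈ Finset.Ioc 0 N, chi3 m * (Real.log m / m)| ≤ C := by
  have hb : ∀ N, 2 ≤ N → |∑ m ∈ Finset.Ioc 2 N, chi3 m * (Real.log m / m)| ≤
      Real.log (2+1 : ℕ) / (2+1 : ℕ) := by
    intro N hN
    refine abs_sum_chi3_le (fun n => Real.log n / n) 2 N hN ?_ ?_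
    · intro n hn
      have h3 : (3 : ℝ) ≤ n := by exact_mod_cast hn
      have he := Real.exp_one_lt_d9
      apply Real.log_div_self_antitoneOn
      · simp; linarith
      · simp; linarith
      · simp
    · intro n hn
      exact div_nonneg (Real.log_natCast_nonneg n) (by positivity)
  refine ⟨Real.log (2+1 : ℕ) / (2+1 : ℕ) + ∑ m ∈ Finset.Ioc 0 2, |chi3 m * (Real.log m / m)|, ?_⟩
  intro N
  rcases le_total 2 N with h | h
  · rw [sum_Ioc_split _ h, add_comm]
    refine (abs_add_le _ _).trans (add_le_add (hb N h) (Finset.abs_sum_le_sum_abs _ _))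
  · refine (Finset.abs_sum_le_sum_abs _ _).trans ?_
    have : ∑ m ∈ Finset.Ioc 0 N, |chi3 m * (Real.log m / m)| ≤
      ∑ m ∈ Finset.Ioc 0 2, |chi3 m * (Real.log m / m)| :=
      Finset.sum_le_sum_of_subset_of_nonneg (Finset.Ioc_subset_Ioc_right h)
        (fun _ _ _ => abs_nonneg _)
    have h0 : 0 ≤ Real.log (2+1 : ℕ) / (2+1 : ℕ) := div_nonneg (Real.log_natCast_nonneg _) (by positivity)
    linarith

open ArithmeticFunction in
lemma sum_vM_le (N : ℕ) : ∑ d ∈ Finset.Ioc 0 N, vonMangoldt d ≤ (Real.log 4 + 4) * N := by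
  have := Chebyshev.psi_le_const_mul_self (x := (N : ℝ)) (by positivity)
  unfold Chebyshev.psi at this
  simpa using this

open ArithmeticFunction in
lemma sum_vM_div_bdd : ∃ C : ℝ, ∀ N : ℕ, 1 ≤ N →
    |∑ d ∈ Finset.Ioc 0 N, vonMangoldt d / d - Real.log N| ≤ C := by
  refine ⟨Real.log 4 + 5, fun N hN => ?_⟩
  have hNpos : (0 : ℝ) < N := by exact_mod_cast hN
  have h1 := sum_Ioc_mul_zeta_eq_sum vonMangoldt N
  rw [vonMangoldt_mul_zeta] at h1
  have h2 : ∑ n ∈ Finset.Ioc 0 N, (ArithmeticFunction.log n) = Real.log (N.factorial) := by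
    simp only [log_apply]
    clear h1 hNpos hN
    induction N with
    | zero => simp
    | succ n ih =>
      rw [← Finset.insert_Ioc_right_eq_Ioc_add_one (by omega), Finset.sum_insert (by simp), ih,
        Nat.factorial_succ, Nat.cast_mul, Real.log_mul (by positivity) (by positivity)]
  rw [h2] at h1
  have h3 : Real.log N.factorial ≤ N * Real.log N := by
    rw [← Real.log_pow]
    apply Real.log_le_log (by positivity)
    exact_mod_cast Nat.factorial_le_pow N
  have h4 : N * Real.log N - N ≤ Real.log N.factorial := by
    have := Real.pow_div_factorial_le_exp (x := (N : ℝ)) (by positivity) N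
    have := Real.log_le_log (by positivity) this
    rw [Real.log_div (by positivity) (by positivity), Real.log_pow, Real.log_exp] at this
    linarith
  have h5 : ∑ n ∈ Finset.Ioc 0 N, vonMangoldt n * ((N / n : ℕ) : ℝ) ≤
      N * ∑ d ∈ Finset.Ioc 0 N, vonMangoldt d / d := by
    rw [Finset.mul_sum]
    apply Finset.sum_le_sum
    intro d hd
    have := Nat.cast_div_le (α := ℝ) (m := N) (n := d)
    have h0 : 0 ≤ vonMangoldt d := vonMangoldt_nonneg
    calc _ ≤ vonMangoldt d * ((N : ℝ) / d) := by gcongr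
      _ = _ := by ring
  have h6 : N * ∑ d ∈ Finset.Ioc 0 N, vonMangoldt d / d ≤
      ∑ n ∈ Finset.Ioc 0 N, vonMangoldt n * ((N / n : ℕ) : ℝ) + (Real.log 4 + 4) * N := by
    refine le_trans ?_ (add_le_add le_rfl (sum_vM_le N))
    rw [Finset.mul_sum, ← Finset.sum_add_distrib]
    apply Finset.sum_le_sum
    intro d hd
    have hd0 : 0 < d := (Finset.mem_Ioc.1 hd).1
    have h0 : 0 ≤ vonMangoldt d := vonMangoldt_nonneg
    have : (N : ℝ) / d ≤ ((N / d : ℕ) : ℝ) + 1 := by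
      rw [← Nat.floor_div_eq_div (K := ℝ)]
      exact (Nat.lt_floor_add_one _).le
    calc _ = vonMangoldt d * ((N : ℝ) / d) := by ring
      _ ≤ vonMangoldt d * (((N / d : ℕ) : ℝ) + 1) := by gcongr
      _ = _ := by ring
  rw [← h1] at h5 h6
  have hl4 : 0 ≤ Real.log 4 := Real.log_nonneg (by norm_num)
  rw [abs_le]
  constructor
  · apply le_of_mul_le_mul_left _ hNpos
    nlinarith
  · apply le_of_mul_le_mul_left _ hNpos
    nlinarith

open ArithmeticFunction in
lemma sum_chi3_vM_bdd : ∃ C : ℝ, ∀ N : ℕ, 1 ≤ N →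
    |∑ d ∈ Finset.Ioc 0 N, chi3 d * vonMangoldt d / d| ≤ C := by
  obtain ⟨L, hL, hT⟩ := exists_L3
  obtain ⟨C, hC⟩ := sum_chi3_log_bdd
  refine ⟨2 * (C + (Real.log 4 + 4)), fun N hN => ?_⟩
  have hNpos : (0 : ℝ) < N := by exact_mod_cast hN
  let f : ArithmeticFunction ℝ := ⟨fun d => chi3 d * vonMangoldt d / d, by simp⟩
  let g : ArithmeticFunction ℝ := ⟨fun d => chi3 d / d, by simp⟩
  have h1 := sum_Ioc_mul_eq_sum_sum f g N
  have h2 : ∀ n, (f * g) n = chi3 n * (Real.log n / n) := by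
    intro n
    rw [mul_apply, ← vonMangoldt_sum, ← Nat.sum_divisorsAntidiagonal (fun i _ => vonMangoldt i),
      Finset.sum_div, Finset.mul_sum]
    apply Finset.sum_congr rfl
    rintro ⟨a, b⟩ hab
    obtain ⟨rfl, -⟩ := Nat.mem_divisorsAntidiagonal.1 hab
    simp only [f, g, coe_mk, chi3_mul]
    push_cast
    field_simp
  have h3 : ∀ M, ∑ m ∈ Finset.Ioc 0 M, g m = T3 M := fun M => rfl
  simp only [h2, h3] at h1
  have h4 : |∑ n ∈ Finset.Ioc 0 N, f n * T3 (N / n) - (∑ n ∈ Finset.Ioc 0 N, f n) * L| ≤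
      Real.log 4 + 4 := by
    rw [Finset.sum_mul, ← Finset.sum_sub_distrib]
    refine (Finset.abs_sum_le_sum_abs _ _).trans ?_
    have : ∑ d ∈ Finset.Ioc 0 N, vonMangoldt d / N ≤ Real.log 4 + 4 := by
      rw [← Finset.sum_div, div_le_iff₀ hNpos]
      exact sum_vM_le N
    refine le_trans (Finset.sum_le_sum ?_) this
    intro d hd
    have hd0 : 0 < d := (Finset.mem_Ioc.1 hd).1
    have hd0' : (0 : ℝ) < d := by exact_mod_cast hd0
    have h0 : 0 ≤ vonMangoldt d := vonMangoldt_nonneg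
    have hfl : (N : ℝ) / d ≤ ((N / d : ℕ) : ℝ) + 1 := by
      rw [← Nat.floor_div_eq_div (K := ℝ)]
      exact (Nat.lt_floor_add_one _).le
    rw [← mul_sub, abs_mul]
    have e1 : |f d| ≤ vonMangoldt d / d := by
      simp only [f, coe_mk]
      rw [abs_div, abs_mul, abs_of_nonneg h0, abs_of_pos hd0']
      gcongr
      exact mul_le_of_le_one_left h0 (abs_chi3_le d)
    have e2 : |T3 (N / d) - L| ≤ d / N := by
      refine (hT (N / d)).trans ?_
      rw [← one_div_div (N : ℝ) d]
      apply one_div_le_one_div_of_le (by positivity) hfl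
    calc _ ≤ (vonMangoldt d / d) * (d / N) := by gcongr
      _ = _ := by field_simp
  rw [← h1] at h4
  have h5 := abs_le.1 (hC N)
  have h6 := abs_le.1 h4
  change |∑ n ∈ Finset.Ioc 0 N, f n| ≤ _
  set S := ∑ n ∈ Finset.Ioc 0 N, f n
  have h7 : |S| * L ≤ C + (Real.log 4 + 4) := by
    rw [← abs_of_nonneg (by linarith : 0 ≤ L), ← abs_mul, abs_le]
    constructor <;> linarith
  have := abs_nonneg S
  nlinarith

noncomputable def a3 (n : ℕ) : ℝ := if n.Prime ∧ n % 3 = 1 then Real.log n / n else 0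

open ArithmeticFunction in
lemma sum_rem_bdd : ∃ R : ℝ, ∀ N : ℕ,
    |∑ n ∈ Finset.Ioc 0 N, (vonMangoldt n / n + chi3 n * vonMangoldt n / n - 2 * a3 n)| ≤ R := by
  let F : ℕ → ℝ := fun n => (if n.Prime then 0 else vonMangoldt n) / n
  have hF : Summable F := by
    have := vonMangoldt.summable_residueClass_non_primes_div (q := 1) 0
    convert this using 5
    simp [vonMangoldt.residueClass, Set.indicator, Subsingleton.elim _ (0 : ZMod 1)]
  let G : ℕ → ℝ := fun n => 2 * F n + (if n = 3 then Real.log 3 / 3 else 0)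
  have hG : Summable G :=
    (hF.mul_left 2).add (summable_of_ne_finset_zero (s := {3}) (by intro b hb; simp_all))
  have hF0 : ∀ n, 0 ≤ F n := by
    intro n
    simp only [F]
    split_ifs
    · simp
    · exact div_nonneg vonMangoldt_nonneg (by positivity)
  have hl3 : 0 ≤ Real.log 3 / 3 := div_nonneg (Real.log_nonneg (by norm_num)) (by norm_num)
  have hG0 : ∀ n, 0 ≤ G n := by
    intro n
    simp only [G]
    have := hF0 n
    split_ifs <;> linarith
  refine ⟨∑' n, G n, fun N => ?_⟩
  refine (Finset.abs_sum_le_sum_abs _ _).trans ?_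
  refine le_trans (Finset.sum_le_sum ?_) (hG.sum_le_tsum (Finset.Ioc 0 N) (fun i _ => hG0 i))
  intro n hn
  by_cases hp : n.Prime
  · have hv : vonMangoldt n = Real.log n := vonMangoldt_apply_prime hp
    rw [hv]
    have : n % 3 = 0 ∨ n % 3 = 1 ∨ n % 3 = 2 := by omega
    rcases this with h | h | h
    · have h3 : n = 3 := by
        have := (Nat.prime_dvd_prime_iff_eq Nat.prime_three hp).1 (Nat.dvd_of_mod_eq_zero h)
        exact this.symm
      subst h3
      simp [G, F, chi3, a3, hp, abs_of_nonneg hl3]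
    · simp only [chi3, a3, h, hp]
      norm_num
      rw [show Real.log n / n + Real.log n / n - 2 * (Real.log n / n) = 0 by ring]
      simpa using hG0 n
    · simp only [chi3, a3, h, hp]
      norm_num
      rw [show Real.log n / n + -Real.log n / n = 0 by ring]
      simpa using hG0 n
  · simp only [a3, hp, G, F]
    have h0 : 0 ≤ vonMangoldt n / n := div_nonneg vonMangoldt_nonneg (by positivity)
    have hc := abs_chi3_le n
    have : |vonMangoldt n / n + chi3 n * vonMangoldt n / n| ≤ 2 * (vonMangoldt n / n) := by
      refine (abs_add_le _ _).trans ?_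
      rw [mul_div_assoc, abs_mul, abs_of_nonneg h0]
      nlinarith
    simp
    split_ifs <;> linarith

lemma sum_a3_bdd : ∃ C : ℝ, ∀ N : ℕ, 1 ≤ N →
    |∑ n ∈ Finset.Ioc 0 N, (a3 n - 1 / 2 * (1 / (n : ℝ)))| ≤ C := by
  obtain ⟨R, hR⟩ := sum_rem_bdd
  obtain ⟨C1, h1⟩ := sum_vM_div_bdd
  obtain ⟨C2, h2⟩ := sum_chi3_vM_bdd
  refine ⟨(R + C1 + C2 + 1) / 2, fun N hN => ?_⟩
  have hh : ((harmonic N : ℚ) : ℝ) = ∑ n ∈ Finset.Ioc 0 N, 1 / (n : ℝ) := by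
    rw [harmonic_eq_sum_Icc]
    push_cast
    simp [← Finset.Icc_add_one_left_eq_Ioc]
  have u1 := log_add_one_le_harmonic N
  have u2 := harmonic_le_one_add_log N
  have u3 : Real.log N ≤ Real.log ((N + 1 : ℕ) : ℝ) := by
    apply Real.log_le_log (by exact_mod_cast hN); push_cast; linarith
  rw [hh] at u1 u2
  have a1 := abs_le.1 (hR N)
  have a2 := abs_le.1 (h1 N hN)
  have a4 := abs_le.1 (h2 N hN)
  rw [Finset.sum_sub_distrib, Finset.sum_add_distrib, ← Finset.mul_sum] at a1
  rw [Finset.sum_sub_distrib, ← Finset.mul_sum, abs_le]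
  constructor <;> linarith

noncomputable def u3 (n : ℕ) : ℝ :=
  (if n.Prime ∧ n % 3 = 1 then - Real.log (1 - 1 / (n : ℝ)) else 0) -
    1 / 2 * (Real.log (Real.log ((n : ℝ) + 1)) - Real.log (Real.log n))

lemma conv1 : ∃ c : ℝ, Tendsto (fun N => ∑ i ∈ Finset.range N,
    (1 / Real.log ((i + 2 : ℕ) : ℝ)) • (a3 (i + 2) - 1 / 2 * (1 / ((i + 2 : ℕ) : ℝ)))) atTop (nhds c) := by
  obtain ⟨C, hC⟩ := sum_a3_bdd
  refine cauchySeq_tendsto_of_complete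
    (Antitone.cauchySeq_series_mul_of_tendsto_zero_of_bounded (b := C + 1 / 2) ?_ ?_ ?_)
  · intro i j hij
    have : (2 : ℝ) ≤ ((i + 2 : ℕ) : ℝ) := by push_cast; linarith [(Nat.cast_nonneg i : (0 : ℝ) ≤ i)]
    apply one_div_le_one_div_of_le
    · exact Real.log_pos (by linarith)
    · apply Real.log_le_log (by linarith)
      exact_mod_cast Nat.add_le_add_right hij 2
  · have h : Tendsto (fun i : ℕ => Real.log ((i + 2 : ℕ) : ℝ)) atTop atTop :=
      Real.tendsto_log_atTop.comp
        (tendsto_natCast_atTop_atTop.comp (tendsto_add_atTop_nat 2))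
    simp only [one_div]
    exact h.inv_tendsto_atTop
  · intro N
    have key : ∑ n ∈ Finset.Ioc 0 (N + 1), (a3 n - 1 / 2 * (1 / (n : ℝ))) =
        ∑ i ∈ Finset.range N, (a3 (i + 2) - 1 / 2 * (1 / ((i + 2 : ℕ) : ℝ))) - 1 / 2 := by
      induction N with
      | zero => simp [a3, Nat.not_prime_one]
      | succ n ih =>
        rw [← Finset.insert_Ioc_right_eq_Ioc_add_one (by omega), Finset.sum_insert (by simp), ih,
          Finset.sum_range_succ]
        ring
    have := abs_le.1 (hC (N + 1) (by omega))
    rw [key] at this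
    rw [Real.norm_eq_abs, abs_le]
    constructor <;> linarith

lemma conv2 : Summable (fun i : ℕ => if (i + 2).Prime ∧ (i + 2) % 3 = 1 then
    - Real.log (1 - 1 / ((i + 2 : ℕ) : ℝ)) - 1 / ((i + 2 : ℕ) : ℝ) else 0) := by
  have hs : Summable (fun i : ℕ => 2 * (1 / ((i + 2 : ℕ) : ℝ) ^ 2)) :=
    ((summable_nat_add_iff 2).2 (Real.summable_one_div_nat_pow.2 one_lt_two)).mul_left 2
  refine Summable.of_norm_bounded hs (fun i => ?_)
  have h2 : (2 : ℝ) ≤ ((i + 2 : ℕ) : ℝ) := by push_cast; linarith [(Nat.cast_nonneg i : (0 : ℝ) ≤ i)]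
  set y := ((i + 2 : ℕ) : ℝ)
  split_ifs
  · have hx0 : 0 < 1 / y := by positivity
    have hx1 : 1 / y ≤ 1 / 2 := one_div_le_one_div_of_le (by norm_num) h2
    have := Real.abs_log_sub_add_sum_range_le (x := 1 / y) (by rw [abs_of_pos hx0]; linarith) 1
    rw [abs_of_pos hx0] at this
    simp only [Finset.sum_range_one] at this
    norm_num at this
    rw [Real.norm_eq_abs, show -Real.log (1 - 1 / y) - 1 / y = -(y⁻¹ + Real.log (1 - y⁻¹)) by
      rw [one_div]; ring, abs_neg]
    refine this.trans ?_
    rw [one_div] at hx0 hx1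
    rw [div_le_iff₀ (by linarith)]
    have : 0 ≤ (y ^ 2)⁻¹ := by positivity
    rw [one_div]
    nlinarith
  · simp; positivity

lemma loglog_bound (y : ℝ) (hy : 2 ≤ y) :
    1 / ((y + 1) * Real.log (y + 1)) ≤ Real.log (Real.log (y + 1)) - Real.log (Real.log y) ∧
    Real.log (Real.log (y + 1)) - Real.log (Real.log y) ≤ 1 / (y * Real.log y) := by
  have hd : ∀ x, 1 < x → HasDerivAt (fun x => Real.log (Real.log x)) (1 / (x * Real.log x)) x := by
    intro x hx
    have hl := Real.log_pos hx
    convert (Real.hasDerivAt_log (by linarith : x ≠ 0)).log hl.ne' using 1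
    field_simp
  obtain ⟨c, ⟨hc1, hc2⟩, hc⟩ := exists_hasDerivAt_eq_slope (fun x => Real.log (Real.log x))
    (fun x => 1 / (x * Real.log x)) (by linarith : y < y + 1)
    (fun x hx => (hd x (by linarith [hx.1])).continuousAt.continuousWithinAt)
    (fun x hx => hd x (by linarith [hx.1]))
  rw [add_sub_cancel_left, div_one] at hc
  rw [← hc]
  have l1 : 0 < Real.log y := Real.log_pos (by linarith)
  have l2 : Real.log y ≤ Real.log c := Real.log_le_log (by linarith) hc1.le
  have l3 : Real.log c ≤ Real.log (y + 1) := Real.log_le_log (by linarith) hc2.le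
  constructor
  · apply one_div_le_one_div_of_le
    · apply mul_pos <;> linarith
    · apply mul_le_mul hc2.le l3 <;> linarith
  · apply one_div_le_one_div_of_le
    · apply mul_pos <;> linarith
    · apply mul_le_mul hc1.le l2 <;> linarith

lemma conv3 : Summable (fun i : ℕ =>
    1 / (((i + 2 : ℕ) : ℝ) * Real.log ((i + 2 : ℕ) : ℝ)) -
    (Real.log (Real.log (((i + 2 : ℕ) : ℝ) + 1)) - Real.log (Real.log ((i + 2 : ℕ) : ℝ)))) := by
  have h2 (i : ℕ) : (2 : ℝ) ≤ ((i + 2 : ℕ) : ℝ) := by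
    push_cast; linarith [(Nat.cast_nonneg i : (0 : ℝ) ≤ i)]
  let h : ℕ → ℝ := fun i => 1 / (((i + 2 : ℕ) : ℝ) * Real.log ((i + 2 : ℕ) : ℝ))
  refine summable_of_sum_range_le (c := h 0) ?_ ?_
  · intro i
    linarith [(loglog_bound _ (h2 i)).2]
  · intro n
    have : ∑ i ∈ Finset.range n, (h i - h (i + 1)) = h 0 - h n := Finset.sum_range_sub' h n
    have hn : 0 ≤ h n := by
      have := Real.log_natCast_nonneg (n + 2)
      positivity
    refine le_trans (Finset.sum_le_sum ?_) (this.le.trans (by linarith))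
    intro i _
    have := (loglog_bound _ (h2 i)).1
    have e : h (i + 1) = 1 / ((((i + 2 : ℕ) : ℝ) + 1) * Real.log (((i + 2 : ℕ) : ℝ) + 1)) := by
      simp only [h]; push_cast; ring_nf
    rw [e]
    simp only [h]
    linarith

lemma conv_u3 : ∃ c : ℝ, Tendsto (fun N => ∑ i ∈ Finset.range N, u3 (i + 2)) atTop (nhds c) := by
  obtain ⟨c, hc⟩ := conv1
  have h2 := conv2.hasSum.tendsto_sum_nat
  have h3 := (conv3.hasSum.tendsto_sum_nat).const_mul (1 / 2)
  refine ⟨_, ((hc.add h2).add h3).congr (fun N => ?_)⟩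
  rw [Finset.mul_sum, ← Finset.sum_add_distrib, ← Finset.sum_add_distrib]
  apply Finset.sum_congr rfl
  intro i _
  have h2 : (2 : ℝ) ≤ ((i + 2 : ℕ) : ℝ) := by
    push_cast; linarith [(Nat.cast_nonneg i : (0 : ℝ) ≤ i)]
  have hl : 0 < Real.log ((i + 2 : ℕ) : ℝ) := Real.log_pos (by linarith)
  unfold u3 a3
  set y := ((i + 2 : ℕ) : ℝ)
  rw [smul_eq_mul]
  split_ifs
  · have : 1 / Real.log y * (Real.log y / y - 1 / 2 * (1 / y)) =
      1 / y - 1 / 2 * (1 / (y * Real.log y)) := by field_simp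
    rw [this]; ring
  · have : 1 / Real.log y * (0 - 1 / 2 * (1 / y)) =
      - (1 / 2 * (1 / (y * Real.log y))) := by field_simp; ring
    rw [this]; ring

lemma sum_u3 (N : ℕ) : Real.exp (∑ i ∈ Finset.range N, u3 (i + 2)) =
    (∏ p ∈ Finset.filter (fun p => Nat.Prime p ∧ p % 3 = 1)
        (Finset.range (N + 2)), ((1 : ℝ) - 1 / (p : ℝ))⁻¹) *
      (Real.sqrt (Real.log 2) / Real.sqrt (Real.log ((N : ℝ) + 2))) := by
  induction N with
  | zero =>
    have : Finset.filter (fun p => Nat.Prime p ∧ p % 3 = 1) (Finset.range (0 + 2)) = ∅ := by decide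
    have h2 : Real.sqrt (Real.log 2) ≠ 0 := (Real.sqrt_pos.2 (Real.log_pos (by norm_num))).ne'
    rw [this]
    simp [h2]
  | succ n ih =>
    have hn : (0 : ℝ) ≤ n := Nat.cast_nonneg n
    have l1 : 0 < Real.log ((n : ℝ) + 2) := Real.log_pos (by linarith)
    have l2 : 0 < Real.log ((n : ℝ) + 3) := Real.log_pos (by linarith)
    have s1 := Real.sqrt_pos.2 l1
    have s2 := Real.sqrt_pos.2 l2
    have e : ∀ z : ℝ, 0 < z → Real.exp (1 / 2 * Real.log z) = Real.sqrt z := by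
      intro z hz
      rw [Real.sqrt_eq_rpow, Real.rpow_def_of_pos hz, mul_comm]
    rw [Finset.sum_range_succ, Real.exp_add, ih, show n + 1 + 2 = (n + 2) + 1 by ring,
      Finset.range_add_one (n := n + 2), Finset.filter_insert]
    have c1 : ((n + 2 : ℕ) : ℝ) = (n : ℝ) + 2 := by push_cast; ring
    have c2 : ((n + 1 : ℕ) : ℝ) + 2 = (n : ℝ) + 3 := by push_cast; ring
    unfold u3
    rw [Real.exp_sub, mul_sub, Real.exp_sub, c1, c2, show (n : ℝ) + 2 + 1 = n + 3 by ring,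
      e _ l1, e _ l2]
    split_ifs with h
    · rw [Finset.prod_insert (by simp), c1, Real.exp_neg, Real.exp_log]
      · field_simp
      · have : 1 / ((n : ℝ) + 2) < 1 := by rw [div_lt_one] <;> linarith
        linarith
    · rw [Real.exp_zero]; field_simp

lemma ratio_lim : Tendsto (fun x : ℝ => Real.sqrt (Real.log ((⌊x⌋₊ : ℝ) + 1)) / Real.sqrt (Real.log x))
    atTop (nhds 1) := by
  have h : Tendsto (fun x : ℝ => Real.log ((⌊x⌋₊ : ℝ) + 1) / Real.log x) atTop (nhds 1) := by
    have hl := Real.tendsto_log_atTop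
    have h1 : Tendsto (fun x : ℝ => 1 + Real.log 2 / Real.log x) atTop (nhds 1) := by
      simpa using (tendsto_const_nhds (x := (1 : ℝ))).add (hl.const_div_atTop (Real.log 2))
    refine tendsto_of_tendsto_of_tendsto_of_le_of_le' tendsto_const_nhds h1 ?_ ?_
    · filter_upwards [eventually_gt_atTop 1] with x hx
      have hp := Real.log_pos hx
      rw [le_div_iff₀ hp, one_mul]
      exact Real.log_le_log (by linarith) (Nat.lt_floor_add_one x).le
    · filter_upwards [eventually_gt_atTop 1] with x hx
      have hp := Real.log_pos hx
      rw [div_le_iff₀ hp, add_mul, div_mul_cancel₀ _ hp.ne', one_mul,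
        ← Real.log_mul (by linarith) (by norm_num)]
      apply Real.log_le_log (by positivity)
      have := Nat.floor_le (by linarith : 0 ≤ x)
      linarith
  have := h.sqrt
  rw [Real.sqrt_one] at this
  refine this.congr' ?_
  filter_upwards with x
  rw [Real.sqrt_div]
  apply Real.log_nonneg
  linarith [(Nat.cast_nonneg ⌊x⌋₊ : (0 : ℝ) ≤ ⌊x⌋₊)]

/-- There is a constant `K > 0` such that, as `x → ∞`,
`( ∏_{p ≤ x, p prime, p ≡ 1 (mod 3)} (1 - 1/p)⁻¹ ) / √(log x)` tends to `K`. -/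
theorem mertens_primes_one_mod_three :
    ∃ K : ℝ, 0 < K ∧
      Tendsto (fun x : ℝ =>
          (∏ p ∈ Finset.filter (fun p => Nat.Prime p ∧ p % 3 = 1)
              (Finset.range (Nat.floor x + 1)), ((1 : ℝ) - 1 / (p : ℝ))⁻¹) /
            Real.sqrt (Real.log x))
        atTop (nhds K) := by
  obtain ⟨c, hc⟩ := conv_u3
  have s2 : 0 < Real.sqrt (Real.log 2) := Real.sqrt_pos.2 (Real.log_pos (by norm_num))
  refine ⟨Real.exp c / Real.sqrt (Real.log 2), by positivity, ?_⟩
  have h1 : Tendsto (fun x : ℝ => ⌊x⌋₊ - 1) atTop atTop :=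
    (tendsto_sub_atTop_nat 1).comp tendsto_nat_floor_atTop
  have h2 := (((Real.continuous_exp.tendsto c).comp (hc.comp h1)).div_const
    (Real.sqrt (Real.log 2))).mul ratio_lim
  rw [mul_one] at h2
  refine h2.congr' ?_
  filter_upwards [eventually_gt_atTop 1] with x hx
  have hf : 1 ≤ ⌊x⌋₊ := (Nat.one_le_floor_iff x).2 hx.le
  simp only [Function.comp]
  rw [sum_u3]
  have e1 : ⌊x⌋₊ - 1 + 2 = ⌊x⌋₊ + 1 := by omega
  have e2 : ((⌊x⌋₊ - 1 : ℕ) : ℝ) + 2 = (⌊x⌋₊ : ℝ) + 1 := by exact_mod_cast e1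
  rw [e1, e2]
  have hf' : (1 : ℝ) ≤ (⌊x⌋₊ : ℝ) := by exact_mod_cast hf
  have s3 : 0 < Real.sqrt (Real.log ((⌊x⌋₊ : ℝ) + 1)) :=
    Real.sqrt_pos.2 (Real.log_pos (by linarith))
  field_simp
end

section
/- Let N be an odd prime and let C be a subring of the ring of 2×2 matrices over ℤ/Nℤ such that C is a field with exactly N² elements. Then the nonzero elements of C act transitively on the nonzero vectors of (ℤ/Nℤ)²: for all nonzero v, w ∈ (ℤ/Nℤ)² there exists a nonzero c ∈ C with c·v = w (matrix–vector multiplication). -/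
/-- Let `N` be an odd prime and let `C` be a subring of the ring of `2 × 2`
matrices over `ℤ/Nℤ` which is a field with exactly `N²` elements (a nonsplit Cartan
subalgebra).  Then the nonzero elements of `C` act transitively on the nonzero vectors of
`(ℤ/Nℤ)²`: for all nonzero `v, w` there is a nonzero `c ∈ C` with `c · v = w`. -/
theorem nonsplitCartan_transitive (N : ℕ) (hN : N.Prime) (hodd : Odd N)
    (C : Subring (Matrix (Fin 2) (Fin 2) (ZMod N)))
    (hfield : IsField C) (hcard : Nat.card C = N ^ 2) :
    ∀ v w : Fin 2 → ZMod N, v ≠ 0 → w ≠ 0 →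
      ∃ c : Matrix (Fin 2) (Fin 2) (ZMod N), c ∈ C ∧ c ≠ 0 ∧ c.mulVec v = w := by
  intro v w hv hw
  haveI : Fact N.Prime := ⟨hN⟩
  have hinj : Function.Injective (fun c : C => c.1.mulVec v) := by
    intro a b hab
    by_contra hne
    obtain ⟨d, hd⟩ := hfield.mul_inv_cancel (sub_ne_zero.mpr hne)
    rw [hfield.mul_comm] at hd
    have h1 : d.1 * (a.1 - b.1) = 1 := congrArg Subtype.val hd
    have h2 : (a.1 - b.1).mulVec v = 0 := by
      rw [Matrix.sub_mulVec]
      exact sub_eq_zero.mpr hab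
    apply hv
    rw [← Matrix.one_mulVec v, ← h1, ← Matrix.mulVec_mulVec, h2, Matrix.mulVec_zero]
  have hbij := (Nat.bijective_iff_injective_and_card (fun c : C => c.1.mulVec v)).mpr
    ⟨hinj, by rw [hcard]; simp [Nat.card_eq_fintype_card, ZMod.card]⟩
  obtain ⟨c, hc⟩ := hbij.2 w
  refine ⟨c.1, c.2, ?_, hc⟩
  intro h0
  apply hw
  rw [← hc]
  simp [h0]
end

section
/- There exists a constant C > 0 such that for every number field K with [K:ℚ] = 2 admitting no ring homomorphism into ℝ (i.e., every imaginary quadratic field K), the class number h(K) satisfies h(K) ≤ C · √|d_K| · log|d_K|, where d_K is the discriminant of K. -/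
open NumberField in
/-- The rational prime below a prime ideal. -/
noncomputable def ratPrime {K : Type} [Field K] [NumberField K] (P : Ideal (𝓞 K)) : ℕ :=
  (Ideal.absNorm P).minFac

open NumberField in
lemma ratPrime_spec {K : Type} [Field K] [NumberField K] {P : Ideal (𝓞 K)} (hP : Prime P) :
    ∃ n, 0 < n ∧ (ratPrime P).Prime ∧ ((ratPrime P : ℕ) : 𝓞 K) ∈ P ∧
      Ideal.absNorm P = ratPrime P ^ n := by
  have h1 : P.IsPrime := Ideal.isPrime_of_prime hP
  have h2 : P.IsMaximal := h1.isMaximal hP.ne_zero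
  obtain ⟨p, n, hn, hpP, hp, hN⟩ := Ideal.exists_prime_and_absNorm_eq_pow P
  have h3 : ratPrime P = p := by
    unfold ratPrime
    rw [hN, Nat.Prime.pow_minFac hp hn.ne']
  rw [h3]
  exact ⟨n, hn, hp, hpP, hN⟩

open NumberField in
lemma no_three_primes {K : Type} [Field K] [NumberField K] (hK : Module.finrank ℚ K = 2)
    {P Q R : Ideal (𝓞 K)} (hP : Prime P) (hQ : Prime Q) (hR : Prime R)
    (hPQ : P ≠ Q) (hPR : P ≠ R) (hQR : Q ≠ R)
    (h1 : ratPrime P = ratPrime Q) (h2 : ratPrime P = ratPrime R) : False := by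
  obtain ⟨a, ha, hp, hpP, hNP⟩ := ratPrime_spec hP
  obtain ⟨b, hb, -, hpQ, hNQ⟩ := ratPrime_spec hQ
  obtain ⟨c, hc, -, hpR, hNR⟩ := ratPrime_spec hR
  rw [← h1] at hpQ hNQ
  rw [← h2] at hpR hNR
  set p := ratPrime P
  have dvdof : ∀ {I : Ideal (𝓞 K)}, ((p : ℕ) : 𝓞 K) ∈ I →
      I ∣ Ideal.span {((p : ℕ) : 𝓞 K)} := fun h =>
    Ideal.dvd_iff_le.mpr ((Ideal.span_singleton_le_iff_mem _).mpr h)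
  have ndvd : ∀ {I J : Ideal (𝓞 K)}, Prime I → Prime J → I ≠ J → ¬ I ∣ J := by
    intro I J hI hJ hne h
    exact hne (associated_iff_eq.mp ((Prime.dvd_prime_iff_associated hI hJ).mp h))
  have hdvd : P * Q * R ∣ Ideal.span {((p : ℕ) : 𝓞 K)} := by
    obtain ⟨X, hX⟩ := dvdof hpP
    have hQX : Q ∣ X := by
      have := dvdof hpQ
      rw [hX] at this
      exact (hQ.dvd_or_dvd this).resolve_left (ndvd hQ hP hPQ.symm)
    obtain ⟨Y, rfl⟩ := hQX
    have hRY : R ∣ Y := by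
      have := dvdof hpR
      rw [hX] at this
      exact ((hR.dvd_or_dvd this).resolve_left (ndvd hR hP hPR.symm) |> hR.dvd_or_dvd).resolve_left
        (ndvd hR hQ hQR.symm)
    obtain ⟨Z, rfl⟩ := hRY
    exact ⟨Z, by rw [hX]; ring⟩
  have hN := map_dvd Ideal.absNorm hdvd
  rw [map_mul, map_mul, hNP, hNQ, hNR, Ideal.absNorm_span_natCast, RingOfIntegers.rank, hK,
    ← pow_add, ← pow_add, Nat.pow_dvd_pow_iff_le_right hp.one_lt] at hN
  omega

open NumberField in
lemma multiset_eq_of_norm_eq {K : Type} [Field K] [NumberField K]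
    (T : Ideal (𝓞 K) → Prop)
    (hT : ∀ P Q, Prime P → Prime Q → T P → T Q → ratPrime P = ratPrime Q → P = Q)
    (s t : Multiset (Ideal (𝓞 K))) (hs : ∀ P ∈ s, Prime P ∧ T P) (ht : ∀ P ∈ t, Prime P ∧ T P)
    (h : (s.map Ideal.absNorm).prod = (t.map Ideal.absNorm).prod) : s = t := by
  classical
  have key : ∀ P, Prime P → T P → ∀ s : Multiset (Ideal (𝓞 K)), (∀ P ∈ s, Prime P ∧ T P) →
      (s.map Ideal.absNorm).prod ≠ 0 ∧
      ((s.map Ideal.absNorm).prod).factorization (ratPrime P) =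
        s.count P * (Ideal.absNorm P).factorization (ratPrime P) := by
    intro P hP hTP s
    induction s using Multiset.induction_on with
    | empty => intro _; simp
    | cons Q s ih =>
      intro hs
      obtain ⟨hQ, hTQ⟩ := hs Q (by simp)
      obtain ⟨i1, i2⟩ := ih (fun P hP => hs P (by simp [hP]))
      obtain ⟨b, hb, hq, -, hNQ⟩ := ratPrime_spec hQ
      have hQ0 : Ideal.absNorm Q ≠ 0 := by rw [hNQ]; exact pow_ne_zero _ hq.ne_zero
      rw [Multiset.map_cons, Multiset.prod_cons]
      refine ⟨mul_ne_zero hQ0 i1, ?_⟩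
      rw [Nat.factorization_mul hQ0 i1, Finsupp.add_apply, i2, Multiset.count_cons]
      by_cases hPQ : P = Q
      · subst hPQ; simp; ring
      · have : ratPrime Q ≠ ratPrime P := fun h => hPQ (hT P Q hP hQ hTP hTQ h.symm)
        rw [if_neg hPQ, hNQ, hq.factorization_pow, Finsupp.single_apply, if_neg this]
        ring
  ext P
  by_cases hP : Prime P ∧ T P
  · have e1 := (key P hP.1 hP.2 s hs).2
    have e2 := (key P hP.1 hP.2 t ht).2
    rw [h, e2] at e1
    obtain ⟨b, hb, hq, -, hNQ⟩ := ratPrime_spec hP.1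
    have : (Ideal.absNorm P).factorization (ratPrime P) ≠ 0 := by
      rw [hNQ, hq.factorization_pow]; simpa using hb.ne'
    exact (mul_right_cancel₀ this e1).symm
  · rw [Multiset.count_eq_zero_of_notMem (fun h => hP (hs P h)),
      Multiset.count_eq_zero_of_notMem (fun h => hP (ht P h))]

open NumberField in
/-- In a quadratic field, nonzero ideals inject into pairs of naturals with product the norm. -/
lemma exists_pair_map {K : Type} [Field K] [NumberField K] (hK : Module.finrank ℚ K = 2) :
    ∃ φ : Ideal (𝓞 K) → ℕ × ℕ, (∀ I, I ≠ 0 → (φ I).1 * (φ I).2 = Ideal.absNorm I) ∧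
      ∀ I J, I ≠ 0 → J ≠ 0 → φ I = φ J → I = J := by
  classical
  let S : Ideal (𝓞 K) → Prop := fun P =>
    P = Classical.epsilon (fun Q : Ideal (𝓞 K) => Prime Q ∧ ratPrime Q = ratPrime P)
  have hS1 : ∀ P Q, Prime P → Prime Q → S P → S Q → ratPrime P = ratPrime Q → P = Q := by
    intro P Q _ _ h1 h2 h
    change P = _ at h1
    change Q = _ at h2
    rw [h1, h2, h]
  have hS2 : ∀ P Q, Prime P → Prime Q → ¬ S P → ¬ S Q → ratPrime P = ratPrime Q → P = Q := by
    intro P Q hP hQ h1 h2 h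
    by_contra hne
    have hR := Classical.epsilon_spec
      (p := fun R : Ideal (𝓞 K) => Prime R ∧ ratPrime R = ratPrime P) ⟨P, hP, rfl⟩
    change ¬ (P = _) at h1
    change ¬ (Q = _) at h2
    rw [← h] at h2
    exact no_three_primes hK hP hQ hR.1 hne h1 h2 h hR.2.symm
  let F : Ideal (𝓞 K) → Multiset (Ideal (𝓞 K)) := UniqueFactorizationMonoid.normalizedFactors
  refine ⟨fun I => ((((F I).filter S).map Ideal.absNorm).prod,
    (((F I).filter (fun P => ¬ S P)).map Ideal.absNorm).prod), ?_, ?_⟩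
  · intro I hI
    change (((F I).filter S).map Ideal.absNorm).prod *
      (((F I).filter (fun P => ¬ S P)).map Ideal.absNorm).prod = _
    rw [← Multiset.prod_add, ← Multiset.map_add, Multiset.filter_add_not, ← map_multiset_prod,
      Ideal.prod_normalizedFactors_eq_self hI]
  · intro I J hI hJ h
    have hp : ∀ {I P : Ideal (𝓞 K)}, P ∈ F I → Prime P := fun h =>
      UniqueFactorizationMonoid.prime_of_normalized_factor _ h
    have e1 := multiset_eq_of_norm_eq S hS1 ((F I).filter S) ((F J).filter S)
      (fun P hP => ⟨hp (Multiset.mem_filter.mp hP).1, (Multiset.mem_filter.mp hP).2⟩)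
      (fun P hP => ⟨hp (Multiset.mem_filter.mp hP).1, (Multiset.mem_filter.mp hP).2⟩)
      (congrArg Prod.fst h)
    have e2 := multiset_eq_of_norm_eq (fun P => ¬ S P) hS2 ((F I).filter (fun P => ¬ S P))
      ((F J).filter (fun P => ¬ S P))
      (fun P hP => ⟨hp (Multiset.mem_filter.mp hP).1, (Multiset.mem_filter.mp hP).2⟩)
      (fun P hP => ⟨hp (Multiset.mem_filter.mp hP).1, (Multiset.mem_filter.mp hP).2⟩)
      (congrArg Prod.snd h)
    have e : F I = F J := by
      rw [← Multiset.filter_add_not S (F I), ← Multiset.filter_add_not S (F J), e1, e2]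
    rw [← Ideal.prod_normalizedFactors_eq_self hI, ← Ideal.prod_normalizedFactors_eq_self hJ]
    exact congrArg Multiset.prod e

/-- The number of pairs with product at most `N`. -/
lemma card_pairs_le (N : ℕ) :
    (((Finset.range N).sigma (fun i => Finset.Icc 1 (N / (i + 1)))).card : ℝ) ≤
      N * (1 + Real.log N) := by
  rw [Finset.card_sigma]
  have h := harmonic_le_one_add_log N
  have h2 : ((∑ i ∈ Finset.range N, (Finset.Icc 1 (N / (i + 1))).card : ℕ) : ℝ) ≤
      N * ((harmonic N : ℚ) : ℝ) := by
    rw [harmonic]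
    push_cast
    rw [Finset.mul_sum]
    apply Finset.sum_le_sum
    intro i _
    rw [Nat.card_Icc, Nat.add_sub_cancel]
    refine (Nat.cast_div_le).trans ?_
    rw [div_eq_mul_inv]
    push_cast
    exact le_rfl
  exact h2.trans (mul_le_mul_of_nonneg_left h (Nat.cast_nonneg N))

open NumberField in
lemma classNumber_le_of_bound {K : Type} [Field K] [NumberField K]
    (hK : Module.finrank ℚ K = 2) (N : ℕ)
    (hN : ∀ C : ClassGroup (𝓞 K), ∃ I : nonZeroDivisors (Ideal (𝓞 K)), ClassGroup.mk0 I = C ∧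
      Ideal.absNorm (I : Ideal (𝓞 K)) ≤ N) :
    (classNumber K : ℝ) ≤ N * (1 + Real.log N) := by
  classical
  obtain ⟨φ, hφ1, hφ2⟩ := exists_pair_map hK
  choose I hI1 hI2 using hN
  have hI0 : ∀ C, (I C : Ideal (𝓞 K)) ≠ 0 := fun C => nonZeroDivisors.coe_ne_zero (I C)
  refine le_trans ?_ (card_pairs_le N)
  rw [classNumber, ← Finset.card_univ]
  have hpos : ∀ C, 0 < (φ (I C)).1 ∧ 0 < (φ (I C)).2 := by
    intro C
    have h1 := hφ1 _ (hI0 C)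
    have h2 := Ideal.absNorm_pos_of_nonZeroDivisors (I C)
    rw [← h1] at h2
    exact ⟨Nat.pos_of_mul_pos_right h2, Nat.pos_of_mul_pos_left h2⟩
  refine Nat.cast_le.mpr (Finset.card_le_card_of_injOn
    (fun C => (⟨(φ (I C)).1 - 1, (φ (I C)).2⟩ : Σ _ : ℕ, ℕ)) ?_ ?_)
  · intro C _
    have h1 := hφ1 _ (hI0 C)
    obtain ⟨ha, hb⟩ := hpos C
    have h2 := hI2 C
    rw [← h1] at h2
    simp only [Finset.coe_sigma, Set.mem_sigma_iff, Finset.mem_coe, Finset.mem_range,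
      Finset.mem_Icc]
    rw [Nat.sub_add_cancel ha, Nat.le_div_iff_mul_le ha]
    refine ⟨?_, hb, by rw [mul_comm]; exact h2⟩
    have : (φ (I C)).1 ≤ N := le_trans (Nat.le_mul_of_pos_right _ hb) h2
    omega
  · intro C _ D _ h
    simp only [Sigma.mk.injEq, heq_eq_eq] at h
    have hC := hpos C
    have hD := hpos D
    have : φ (I C) = φ (I D) := Prod.ext (by omega) h.2
    have := hφ2 _ _ (hI0 C) (hI0 D) this
    rw [← hI1 C, ← hI1 D, Subtype.ext this]

/-- There is a constant `C > 0` such that for every imaginary quadratic field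
`K` (a number field of degree `2` with no ring homomorphism into `ℝ`), the class number of `K`
satisfies `h(K) ≤ C · √|d_K| · log |d_K|`, where `d_K` is the discriminant of `K`. -/
theorem classNumber_le_sqrt_discr_mul_log :
    ∃ C : ℝ, 0 < C ∧ ∀ (K : Type) [Field K] [NumberField K],
      Module.finrank ℚ K = 2 → IsEmpty (K →+* ℝ) →
      (NumberField.classNumber K : ℝ) ≤
        C * Real.sqrt |(NumberField.discr K : ℝ)| * Real.log |(NumberField.discr K : ℝ)| := by
  refine ⟨2, by norm_num, ?_⟩
  intro K _ _ hK _
  have hD3 : (3 : ℝ) ≤ |(NumberField.discr K : ℝ)| := by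
    have h := NumberField.abs_discr_gt_two (K := K) (by omega)
    have h' : (3 : ℤ) ≤ |NumberField.discr K| := by omega
    exact_mod_cast h'
  have hr : NumberField.InfinitePlace.nrComplexPlaces K ≤ 1 := by
    have := NumberField.InfinitePlace.card_add_two_mul_card_eq_rank K
    omega
  have hM : (4 / Real.pi) ^ NumberField.InfinitePlace.nrComplexPlaces K ≤ 2 := by
    have h3 := Real.pi_gt_three
    have h4 : 4 / Real.pi ≤ 2 := by
      rw [div_le_iff₀ Real.pi_pos]; linarith
    interval_cases NumberField.InfinitePlace.nrComplexPlaces K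
    · norm_num
    · simpa using h4
  have hs : 0 ≤ Real.sqrt |(NumberField.discr K : ℝ)| := Real.sqrt_nonneg _
  have hcl := classNumber_le_of_bound hK ⌊Real.sqrt |(NumberField.discr K : ℝ)|⌋₊ (by
    intro C
    obtain ⟨I, h1, h2⟩ := NumberField.exists_ideal_in_class_of_norm_le C
    refine ⟨I, h1, Nat.le_floor (h2.trans ?_)⟩
    rw [hK]
    have h5 : (((2 : ℕ).factorial : ℕ) : ℝ) / ((2 : ℕ) : ℝ) ^ 2 = 1 / 2 := by
      norm_num [Nat.factorial]
    rw [h5]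
    push_cast
    nlinarith)
  generalize |(NumberField.discr K : ℝ)| = D at *
  have hfl := Nat.floor_le hs
  have hfl1 : 1 ≤ ⌊Real.sqrt D⌋₊ := Nat.le_floor (by
    rw [Nat.cast_one, Real.one_le_sqrt]; linarith)
  have hfl1' : (1 : ℝ) ≤ (⌊Real.sqrt D⌋₊ : ℝ) := by exact_mod_cast hfl1
  have hlog : Real.log (⌊Real.sqrt D⌋₊ : ℝ) ≤ Real.log D / 2 := by
    rw [← Real.log_sqrt (by linarith)]
    exact Real.log_le_log (by linarith) hfl
  have hlogD : 1 ≤ Real.log D := by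
    rw [Real.le_log_iff_exp_le (by linarith)]
    linarith [Real.exp_one_lt_d9]
  calc (NumberField.classNumber K : ℝ)
      ≤ (⌊Real.sqrt D⌋₊ : ℝ) * (1 + Real.log (⌊Real.sqrt D⌋₊ : ℝ)) := hcl
    _ ≤ Real.sqrt D * (2 * Real.log D) := by
        apply mul_le_mul hfl (by linarith) _ hs
        linarith [Real.log_nonneg hfl1']
    _ = 2 * Real.sqrt D * Real.log D := by ring
end
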